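/- The number of spanning trees of the wheel graph W_n (a cycle C_n joined with one hub vertex, n ≥ 3) equals L_{2n} - 2, where L is the Lucas sequence defined by L 1 = 1, L 2 = 3, L (k+2) = L (k+1) + L k. -/

import Mathlib

/-- The wheel graph `W_n`: an `n`-cycle on the vertices `0, …, n-1` of `Fin (n+1)`
together with a hub `Fin.last n` adjacent to every rim vertex. -/
def wheelGraph (n : ℕ) : SimpleGraph (Fin (n+1)) :=
  SimpleGraph.fromRel (fun a b =>
    (a.val < n ∧ b.val < n ∧ (a.val + 1) % n = b.val) ∨ b = Fin.last n)

/-- The number of spanning trees of a graph. -/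
noncomputable def numSpanningTrees {V : Type*} (G : SimpleGraph V) : ℕ :=
  Nat.card {H : G.Subgraph // H.IsSpanning ∧ H.coe.IsTree}


/-- The graph of a parent function. -/
def parentGraph {V : Type*} (r : V) (p : V → V) : SimpleGraph V :=
  SimpleGraph.fromRel (fun a b => a ≠ r ∧ p a = b)

def Ranked {V : Type*} (r : V) (p : V → V) : Prop :=
  ∃ d : V → ℕ, ∀ v, v ≠ r → d (p v) < d v

lemma Ranked.adj {V : Type*} {r : V} {p : V → V} (h : Ranked r p) {v : V} (hv : v ≠ r) :
    (parentGraph r p).Adj v (p v) := by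
  obtain ⟨d, hd⟩ := h
  rw [parentGraph, SimpleGraph.fromRel_adj]
  refine ⟨fun e => ?_, Or.inl ⟨hv, rfl⟩⟩
  have := hd v hv
  rw [← e] at this
  exact lt_irrefl _ this

lemma Ranked.connected {V : Type*} {r : V} {p : V → V} (h : Ranked r p) :
    (parentGraph r p).Connected := by
  have key : ∀ v, (parentGraph r p).Reachable v r := by
    obtain ⟨d, hd⟩ := id h
    intro v
    induction hk : d v using Nat.strong_induction_on generalizing v with
    | _ k ih =>
      by_cases hv : v = r
      · rw [hv]
      · exact (h.adj hv).reachable.trans (ih _ (hk ▸ hd v hv) (p v) rfl)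
  have : Nonempty V := ⟨r⟩
  exact ⟨fun u v => (key u).trans (key v).symm⟩

lemma Ranked.isTree {V : Type*} [Fintype V] {r : V} {p : V → V} (h : Ranked r p) :
    (parentGraph r p).IsTree := by
  classical
  rw [SimpleGraph.isTree_iff_connected_and_card]
  refine ⟨h.connected, le_antisymm ?_ h.connected.card_vert_le_card_edgeSet_add_one⟩
  have hsub : (parentGraph r p).edgeSet ⊆ Set.image (fun v => s(v, p v)) {v | v ≠ r} := by
    intro e
    induction e with
    | _ a b =>
      rw [SimpleGraph.mem_edgeSet, parentGraph, SimpleGraph.fromRel_adj]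
      rintro ⟨_, ⟨h1, h2⟩ | ⟨h1, h2⟩⟩
      · exact ⟨a, h1, by simp [h2]⟩
      · exact ⟨b, h1, by simp [h2, Sym2.eq_swap]⟩
  have h1 : Nat.card (parentGraph r p).edgeSet ≤ Set.ncard {v | v ≠ r} := by
    rw [Nat.card_coe_set_eq]
    exact (Set.ncard_le_ncard hsub (Set.toFinite _)).trans (Set.ncard_image_le (Set.toFinite _))
  have h2 : Set.ncard {v | v ≠ r} + 1 = Nat.card V := by
    have := Set.ncard_add_ncard_compl ({r} : Set V)
    rw [Set.ncard_singleton] at this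
    rw [← this, add_comm]
    rfl
  omega

lemma Ranked.inj {V : Type*} {r : V} {p q : V → V} (hp : Ranked r p) 
    (h : parentGraph r p = parentGraph r q) (v : V) (hv : v ≠ r) : p v = q v := by
  obtain ⟨d, hd⟩ := id hp
  induction hk : d v using Nat.strong_induction_on generalizing v with
  | _ k ih =>
    by_contra hne
    have ha := hp.adj hv
    rw [h, parentGraph, SimpleGraph.fromRel_adj] at ha
    rcases ha with ⟨_, ⟨_, h2⟩ | ⟨h1, h2⟩⟩
    · exact hne h2.symm
    · have h3 := ih _ (hk ▸ hd v hv) (p v) h1 rfl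
      rw [h2] at h3
      have h4 := hd _ h1
      have h5 := hd _ hv
      rw [h3] at h4
      omega

lemma exists_parent {V : Type*} [Fintype V] (r : V) {T : SimpleGraph V} (hT : T.IsTree) :
    ∃ p : V → V, p r = r ∧ (∀ v, v ≠ r → T.Adj v (p v)) ∧ Ranked r p ∧ parentGraph r p = T := by
  classical
  have h : ∀ v, ∃ u, (v = r → u = r) ∧ (v ≠ r → T.Adj v u ∧ T.dist u r < T.dist v r) := by
    intro v
    by_cases hv : v = r
    · exact ⟨r, fun _ => rfl, fun h => absurd hv h⟩
    · obtain ⟨w, hw⟩ := hT.1.exists_walk_length_eq_dist v r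
      cases w with
      | nil => exact absurd rfl hv
      | cons ha w' =>
        refine ⟨_, fun h => absurd h hv, fun _ => ⟨ha, ?_⟩⟩
        have := SimpleGraph.dist_le w'
        rw [SimpleGraph.Walk.length_cons] at hw
        omega
  choose p hp1 hp2 using h
  have hR : Ranked r p := ⟨fun v => T.dist v r, fun v hv => (hp2 v hv).2⟩
  have hle : parentGraph r p ≤ T := by
    intro a b hab
    rw [parentGraph, SimpleGraph.fromRel_adj] at hab
    rcases hab with ⟨_, ⟨h1, rfl⟩ | ⟨h1, rfl⟩⟩
    · exact (hp2 _ h1).1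
    · exact (hp2 _ h1).1.symm
  refine ⟨p, hp1 r rfl, fun v hv => (hp2 v hv).1, hR, ?_⟩
  exact le_antisymm hle ((SimpleGraph.isTree_iff_minimal_connected.1 hT).2 hR.connected hle)

lemma ranked_of_reach {V : Type*} {r : V} {p : V → V} (h : ∀ v, ∃ k, p^[k] v = r) : Ranked r p := by
  classical
  refine ⟨fun v => Nat.find (h v), fun v hv => ?_⟩
  have h1 := Nat.find_spec (h v)
  rcases hk : Nat.find (h v) with _ | k
  · rw [hk] at h1; exact absurd h1 hv
  · rw [hk, Function.iterate_succ_apply] at h1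
    have h2 : Nat.find (h (p v)) ≤ k := Nat.find_min' (h (p v)) h1
    change Nat.find (h (p v)) < Nat.find (h v)
    omega

/-- parent function of a word -/
def par {m : ℕ} (w : Fin (m+1) → Fin 3) : Fin (m+2) → Fin (m+2) :=
  Fin.lastCases (Fin.last (m+1)) (fun i =>
    if w i = 0 then Fin.last (m+1) else if w i = 1 then (i+1).castSucc else (i-1).castSucc)

lemma par_last {m : ℕ} (w : Fin (m+1) → Fin 3) : par w (Fin.last (m+1)) = Fin.last (m+1) := by
  simp [par]
lemma par_zero {m : ℕ} (w : Fin (m+1) → Fin 3) (i) (h : w i = 0) :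
    par w i.castSucc = Fin.last (m+1) := by
  simp [par, h]
lemma par_one {m : ℕ} (w : Fin (m+1) → Fin 3) (i) (h : w i = 1) :
    par w i.castSucc = (i+1).castSucc := by
  simp [par, h]
lemma par_two {m : ℕ} (w : Fin (m+1) → Fin 3) (i) (h : w i = 2) :
    par w i.castSucc = (i-1).castSucc := by
  simp [par, h]

lemma fin3 (a : Fin 3) : a = 0 ∨ a = 1 ∨ a = 2 := by revert a; decide

def Good {m : ℕ} (w : Fin (m+1) → Fin 3) : Prop :=
  (∀ i, ¬ (w i = 1 ∧ w (i+1) = 2)) ∧ (¬ ∀ i, w i = 1) ∧ (¬ ∀ i, w i = 2)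

lemma fin_cover {m : ℕ} (P : Fin (m+1) → Prop) (i : Fin (m+1)) (h0 : P i)
    (h : ∀ j, P j → P (j+1)) (j) : P j := by
  have key : ∀ k : ℕ, P (i + (Fin.ofNat (m+1) k)) := by
    intro k
    induction k with
    | zero => simpa using h0
    | succ k ih =>
      have := h _ ih
      convert this using 1
      rw [add_assoc]
      congr 1
      ext
      simp [Fin.val_add]
  have := key (j - i).val
  simpa using this

lemma fin_cover' {m : ℕ} (P : Fin (m+1) → Prop) (i : Fin (m+1)) (h0 : P i)
    (h : ∀ j, P j → P (j-1)) (j) : P j := by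
  have := fin_cover (fun j => P (-j)) (-i) (by simpa using h0) (fun j hj => by
    have := h _ hj
    rwa [show -(j+1) = -j - 1 by abel]) (-j)
  simpa using this

lemma Good.ranked {m : ℕ} {w : Fin (m+1) → Fin 3} (h : Good w) : Ranked (Fin.last (m+1)) (par w) := by
  obtain ⟨h1, h2, h3⟩ := h
  apply ranked_of_reach
  have step : ∀ v, (¬ ∃ k, (par w)^[k] v = Fin.last (m+1)) →
      (¬ ∃ k, (par w)^[k] (par w v) = Fin.last (m+1)) := by
    rintro v hv ⟨k, hk⟩
    exact hv ⟨k+1, hk⟩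
  have hz : ∀ i : Fin (m+1), (¬ ∃ k, (par w)^[k] i.castSucc = Fin.last (m+1)) → w i ≠ 0 := by
    intro i hi h0
    exact hi ⟨1, par_zero w i h0⟩
  intro v
  induction v using Fin.lastCases with
  | last => exact ⟨0, rfl⟩
  | cast i =>
    by_contra hi
    rcases fin3 (w i) with hw | hw | hw
    · exact hz i hi hw
    · refine h2 fun j => (fin_cover (fun j => w j = 1 ∧ ¬ ∃ k, (par w)^[k] j.castSucc = Fin.last (m+1)) i ⟨hw, hi⟩ ?_ j).1
      rintro j ⟨hj, hj'⟩
      have := step _ hj'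
      rw [par_one w j hj] at this
      refine ⟨?_, this⟩
      rcases fin3 (w (j+1)) with e | e | e
      · exact absurd e (hz _ this)
      · exact e
      · exact absurd ⟨hj, e⟩ (h1 j)
    · refine h3 fun j => (fin_cover' (fun j => w j = 2 ∧ ¬ ∃ k, (par w)^[k] j.castSucc = Fin.last (m+1)) i ⟨hw, hi⟩ ?_ j).1
      rintro j ⟨hj, hj'⟩
      have := step _ hj'
      rw [par_two w j hj] at this
      refine ⟨?_, this⟩
      rcases fin3 (w (j-1)) with e | e | e
      · exact absurd e (hz _ this)
      · exact absurd ⟨e, by simpa using hj⟩ (h1 (j-1))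
      · exact e

lemma good_of_ranked {m : ℕ} {w : Fin (m+1) → Fin 3} (h : Ranked (Fin.last (m+1)) (par w)) : Good w := by
  obtain ⟨d, hd⟩ := h
  have hd' : ∀ i : Fin (m+1), d (par w i.castSucc) < d i.castSucc := fun i => hd _ (Fin.castSucc_lt_last i).ne
  obtain ⟨i0, hi0⟩ := Finite.exists_min (fun i : Fin (m+1) => d i.castSucc)
  refine ⟨?_, ?_, ?_⟩
  · rintro i ⟨h1, h2⟩
    have e1 := hd' i
    have e2 := hd' (i+1)
    rw [par_one w i h1] at e1
    rw [par_two w _ h2, add_sub_cancel_right] at e2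
    omega
  · intro h
    have := hd' i0
    rw [par_one w _ (h _)] at this
    exact absurd (hi0 (i0+1)) (not_le.2 this)
  · intro h
    have := hd' i0
    rw [par_two w _ (h _)] at this
    exact absurd (hi0 (i0-1)) (not_le.2 this)


lemma fin_val_one {m : ℕ} (hm : 2 ≤ m) : ((1 : Fin (m+1)) : ℕ) = 1 := by
  change 1 % (m+1) = 1
  exact Nat.mod_eq_of_lt (by omega)

lemma wheel_adj {m : ℕ} (hm : 2 ≤ m) (i : Fin (m+1)) (b : Fin (m+2)) :
    (wheelGraph (m+1)).Adj i.castSucc b ↔ b = Fin.last (m+1) ∨ b = (i+1).castSucc ∨ b = (i-1).castSucc := by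
  rw [wheelGraph, SimpleGraph.fromRel_adj]
  induction b using Fin.lastCases with
  | last => simp [(Fin.castSucc_lt_last i).ne]
  | cast j =>
    have e1 : ∀ a b : Fin (m+1), (a.val + 1) % (m+1) = b.val ↔ b = a + 1 := by
      intro a b
      rw [Fin.ext_iff, Fin.val_add, eq_comm]
      have : ((1 : Fin (m+1)) : ℕ) = 1 := by
        exact fin_val_one hm
      rw [this]
    have e2 : ∀ a : Fin (m+1), a ≠ a + 1 := by
      intro a h
      have h := (e1 a a).2 h
      have := a.isLt
      rcases Nat.lt_or_ge (a.val+1) (m+1) with h' | h'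
      · rw [Nat.mod_eq_of_lt h'] at h; omega
      · rw [show a.val + 1 = m+1 by omega, Nat.mod_self] at h; omega
    simp only [Fin.val_castSucc, Fin.is_lt, true_and, e1, (Fin.castSucc_lt_last _).ne, or_false, false_or, Fin.castSucc_inj, ne_eq]
    constructor
    · rintro ⟨_, h | h⟩
      · exact Or.inl h
      · right; rw [h]; simp
    · rintro (rfl | rfl)
      · exact ⟨e2 i, Or.inl rfl⟩
      · refine ⟨fun h => e2 (i-1) ?_, Or.inr (by simp)⟩
        simpa using h.symm

lemma plus_ne_minus {m : ℕ} (hm : 2 ≤ m) (i : Fin (m+1)) : i + 1 ≠ i - 1 := by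
  intro h
  have h : (1 : Fin (m+1)) + 1 = 0 := by
    have : i + (1 + 1) = i + 0 := by rw [← add_assoc, h]; simp
    exact add_left_cancel this
  have := congrArg Fin.val h
  rw [Fin.val_add, fin_val_one hm, Nat.mod_eq_of_lt (show 1+1 < m+1 by omega)] at this
  simp at this

lemma par_adj {m : ℕ} (hm : 2 ≤ m) (w : Fin (m+1) → Fin 3) : ∀ v, v ≠ Fin.last (m+1) → (wheelGraph (m+1)).Adj v (par w v) := by
  intro v hv
  induction v using Fin.lastCases with
  | last => exact absurd rfl hv
  | cast i =>
    rw [wheel_adj hm]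
    rcases fin3 (w i) with e | e | e
    · rw [par_zero w i e]; simp
    · rw [par_one w i e]; simp
    · rw [par_two w i e]; simp

lemma par_inj {m : ℕ} (hm : 2 ≤ m) (w w' : Fin (m+1) → Fin 3) (i) (h : par w i.castSucc = par w' i.castSucc) : w i = w' i := by
  have a1 := plus_ne_minus hm i
  have a2 := a1.symm
  rcases fin3 (w i) with e | e | e <;> rcases fin3 (w' i) with e' | e' | e' <;>
    simp [e, e', par, (Fin.castSucc_lt_last _).ne, (Fin.castSucc_lt_last _).ne', a1, a2] at h ⊢

lemma card_trees {m : ℕ} (hm : 2 ≤ m) :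
    Nat.card {w : Fin (m+1) → Fin 3 // Good w} = Nat.card {T : SimpleGraph (Fin (m+2)) // T ≤ wheelGraph (m+1) ∧ T.IsTree} := by
  refine Nat.card_congr (Equiv.ofBijective (fun w => ⟨parentGraph (Fin.last (m+1)) (par w.1), ?_, w.2.ranked.isTree⟩) ⟨?_, ?_⟩)
  · intro a b hab
    rw [parentGraph, SimpleGraph.fromRel_adj] at hab
    rcases hab with ⟨_, ⟨h1, rfl⟩ | ⟨h1, rfl⟩⟩
    · exact par_adj hm _ _ h1
    · exact (par_adj hm _ _ h1).symm
  · rintro ⟨w, hw⟩ ⟨w', hw'⟩ h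
    have h := congrArg Subtype.val h
    apply Subtype.ext
    funext i
    exact par_inj hm _ _ _ (hw.ranked.inj h _ (Fin.castSucc_lt_last i).ne)
  · rintro ⟨T, hle, hT⟩
    obtain ⟨p, hp0, hp1, hR, hpT⟩ := exists_parent (Fin.last (m+1)) hT
    have : ∃ w, par w = p := by
      have hw : ∀ i : Fin (m+1), ∃ a : Fin 3, ∀ w : Fin (m+1) → Fin 3, w i = a → par w i.castSucc = p i.castSucc := by
        intro i
        have := (wheel_adj hm i _).1 (hle (hp1 i.castSucc (Fin.castSucc_lt_last i).ne))
        rcases this with h | h | h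
        · exact ⟨0, fun w hw => by rw [h, par_zero w i hw]⟩
        · exact ⟨1, fun w hw => by rw [h, par_one w i hw]⟩
        · exact ⟨2, fun w hw => by rw [h, par_two w i hw]⟩
      choose w hw using hw
      refine ⟨w, funext fun v => ?_⟩
      induction v using Fin.lastCases with
      | last => rw [par_last, hp0]
      | cast i => exact hw i w rfl
    obtain ⟨w, rfl⟩ := this
    exact ⟨⟨w, good_of_ranked hR⟩, Subtype.ext hpT⟩

lemma numSpanningTrees_eq {V : Type*} (G : SimpleGraph V) :
    numSpanningTrees G = Nat.card {T : SimpleGraph V // T ≤ G ∧ T.IsTree} := by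
  refine Nat.card_congr (Equiv.ofBijective (fun H => ⟨H.1.spanningCoe, H.1.spanningCoe_le, ?_⟩) ⟨?_, ?_⟩)
  · exact (H.1.spanningCoeEquivCoeOfSpanning H.2.1).isTree_iff.2 H.2.2
  · rintro ⟨H, hH, _⟩ ⟨H', hH', _⟩ h
    have h := congrArg Subtype.val h
    apply Subtype.ext
    refine SimpleGraph.Subgraph.ext ?_ ?_
    · rw [SimpleGraph.Subgraph.isSpanning_iff.1 hH, SimpleGraph.Subgraph.isSpanning_iff.1 hH']
    · exact congrArg SimpleGraph.Adj h
  · rintro ⟨T, hle, hT⟩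
    have hs := SimpleGraph.toSubgraph.isSpanning T hle
    have he : (SimpleGraph.toSubgraph T hle).spanningCoe = T := by ext; rfl
    refine ⟨⟨SimpleGraph.toSubgraph T hle, hs, ?_⟩, Subtype.ext he⟩
    rw [← ((SimpleGraph.toSubgraph T hle).spanningCoeEquivCoeOfSpanning hs).isTree_iff, he]
    exact hT
def WM : Matrix (Fin 3) (Fin 3) ℤ := !![1,1,1;1,1,0;1,1,1]

lemma path_sum (n : ℕ) (F : Fin 3 → Fin 3 → ℤ) :
    ∑ w : Fin (n+1) → Fin 3, F (w 0) (w (Fin.last n)) * ∏ i : Fin n, WM (w i.castSucc) (w i.succ)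
      = ∑ a, ∑ b, F a b * (WM ^ n) a b := by
  induction n generalizing F with
  | zero =>
    rw [← (Equiv.funUnique (Fin 1) (Fin 3)).symm.sum_comp]
    simp [Matrix.one_apply]
  | succ n ih =>
    rw [← (Fin.consEquiv (fun _ : Fin (n+2) => Fin 3)).sum_comp, Fintype.sum_prod_type, Finset.sum_comm]
    have h : ∀ w : Fin (n+1) → Fin 3, (∑ c : Fin 3, 
        F ((Fin.consEquiv (fun _ : Fin (n+2) => Fin 3)) (c, w) 0) ((Fin.consEquiv (fun _ : Fin (n+2) => Fin 3)) (c, w) (Fin.last (n+1))) *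
          ∏ i : Fin (n+1), WM ((Fin.consEquiv (fun _ : Fin (n+2) => Fin 3)) (c, w) i.castSucc) ((Fin.consEquiv (fun _ : Fin (n+2) => Fin 3)) (c, w) i.succ))
        = (fun a b => ∑ c, F c b * WM c a) (w 0) (w (Fin.last n)) * ∏ i : Fin n, WM (w i.castSucc) (w i.succ) := by
      intro w
      simp only [Finset.sum_mul]
      refine Finset.sum_congr rfl fun c _ => ?_
      rw [Fin.prod_univ_succ]
      simp [Fin.consEquiv, ← Fin.succ_last, ← Fin.succ_castSucc, -Fin.castSucc_succ, mul_assoc]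
    rw [Finset.sum_congr rfl (fun w _ => h w)]
    refine (ih (fun a b => ∑ c, F c b * WM c a)).trans ?_
    simp only [pow_succ', Matrix.mul_apply, Finset.sum_mul, Finset.mul_sum]
    rw [Finset.sum_comm]
    conv_lhs => enter [2, x]; rw [Finset.sum_comm]
    rw [Finset.sum_comm]
    refine Finset.sum_congr rfl fun c _ => Finset.sum_congr rfl fun b _ => Finset.sum_congr rfl fun a _ => by ring

lemma trace_rec (n : ℕ) : (WM ^ (n+3)).trace = 3 * (WM ^ (n+2)).trace - (WM ^ (n+1)).trace := by
  have h : WM ^ 3 = (3:ℤ) • WM ^ 2 - WM := by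
    simp only [WM, pow_succ, pow_zero, one_mul]; decide
  rw [pow_add, h, mul_sub, Matrix.trace_sub, ← pow_succ, mul_smul_comm, Matrix.trace_smul, ← pow_add]
  simp

lemma trace_lucas (L : ℕ → ℕ)
    (hL1 : L 1 = 1) (hL2 : L 2 = 3)
    (hLrec : ∀ k, 1 ≤ k → L (k+2) = L (k+1) + L k) (n : ℕ) :
    (WM ^ (n+1)).trace = L (2*(n+1)) ∧ (WM ^ (n+2)).trace = L (2*(n+2)) := by
  induction n with
  | zero =>
    have h3 := hLrec 1 (by norm_num)
    have h4 := hLrec 2 (by norm_num)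
    norm_num at h3 h4
    constructor
    · simp [hL2, WM, Matrix.trace, Fin.sum_univ_three]
    · simp only [zero_add]
      norm_num [h4, h3, hL1, hL2]
      simp only [WM, pow_succ, pow_zero, one_mul]; decide
  | succ n ih =>
    refine ⟨ih.2, ?_⟩
    have e := trace_rec n
    rw [ih.1, ih.2] at e
    rw [show n+1+2 = n+3 by ring, e]
    have h1 := hLrec (2*n+2) (by omega)
    have h2 := hLrec (2*n+3) (by omega)
    have h3 := hLrec (2*n+4) (by omega)
    have e1 : 2*(n+1) = 2*n+2 := by ring
    have e2 : 2*(n+2) = 2*n+4 := by ring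
    have e3 : 2*(n+3) = 2*n+6 := by ring
    rw [e1,e2,e3]
    simp only [Nat.add_assoc, Nat.reduceAdd] at h1 h2 h3
    omega

lemma WM_eq (a b : Fin 3) : WM a b = if ¬ (a = 1 ∧ b = 2) then 1 else 0 := by
  fin_cases a <;> fin_cases b <;> simp [WM]

lemma card_noRL (m : ℕ) :
    ((Finset.univ.filter (fun w : Fin (m+1) → Fin 3 => ∀ i, ¬ (w i = 1 ∧ w (i+1) = 2))).card : ℤ)
      = (WM ^ (m+1)).trace := by
  have := path_sum m (fun a b => WM b a)
  rw [pow_succ, Matrix.trace]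
  simp only [Matrix.diag, Matrix.mul_apply]
  rw [Finset.card_filter]
  push_cast
  trans ∑ a, ∑ b, WM b a * (WM ^ m) a b
  · rw [← this]
    refine Finset.sum_congr rfl fun w _ => ?_
    have : WM (w (Fin.last m)) (w 0) * ∏ i : Fin m, WM (w i.castSucc) (w i.succ) = ∏ i : Fin (m+1), WM (w i) (w (i+1)) := by
      rw [Fin.prod_univ_castSucc]
      simp [mul_comm]
    rw [this]
    simp only [WM_eq]
    rw [Finset.prod_boole]
    simp
  · exact Finset.sum_congr rfl fun a _ => Finset.sum_congr rfl fun b _ => mul_comm _ _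

lemma card_good (m : ℕ) : (Nat.card {w : Fin (m+1) → Fin 3 // Good w} : ℤ) = (WM ^ (m+1)).trace - 2 := by
  classical
  rw [← card_noRL, Nat.card_eq_fintype_card, Fintype.card_subtype]
  have : (Finset.univ.filter (fun w : Fin (m+1) → Fin 3 => Good w)) =
     (Finset.univ.filter (fun w : Fin (m+1) → Fin 3 => ∀ i, ¬ (w i = 1 ∧ w (i+1) = 2))) \ {fun _ => 1, fun _ => 2} := by
    ext w
    rw [Finset.mem_filter, Finset.mem_sdiff, Finset.mem_filter]
    simp only [Good, Finset.mem_univ, true_and, Finset.mem_sdiff, Finset.mem_insert, Finset.mem_singleton, funext_iff, not_or]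
  have hne : (fun _ : Fin (m+1) => (1 : Fin 3)) ≠ (fun _ => 2) := fun h => by
    have := congrFun h 0; revert this; decide
  have hs : ({fun _ => 1, fun _ => 2} : Finset (Fin (m+1) → Fin 3)) ⊆ (Finset.univ.filter (fun w : Fin (m+1) → Fin 3 => ∀ i, ¬ (w i = 1 ∧ w (i+1) = 2))) := by
    intro w hw
    simp only [Finset.mem_insert, Finset.mem_singleton] at hw
    rcases hw with rfl | rfl <;> simp
  rw [this, Finset.card_sdiff_of_subset hs, Nat.cast_sub (Finset.card_le_card hs), Finset.card_pair hne]
  simp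

theorem stmt_6 (n : ℕ) (hn : 3 ≤ n) (L : ℕ → ℕ)
    (hL1 : L 1 = 1) (hL2 : L 2 = 3)
    (hLrec : ∀ k, 1 ≤ k → L (k+2) = L (k+1) + L k) :
    numSpanningTrees (wheelGraph n) = L (2*n) - 2 := by
  obtain ⟨m, rfl⟩ : ∃ m, n = m + 1 := ⟨n - 1, by omega⟩
  have h1 := card_good m
  rw [(trace_lucas L hL1 hL2 hLrec m).1, card_trees (by omega), ← numSpanningTrees_eq] at h1
  omega
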